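/- arXiv:1910.10384 — 3 statements merged into one kernel-verified Lean document; each statement's English description precedes it below -/
import Mathlib

section
/- For all k ∈ [K], i ∈ {1,…,K−t} and j ∈ {1,…,t+L}, the set R := {C_k[i,j]} ∪ {C_k[i,j'] : j' ∈ {1,…,t+L}, V[R_k[i,j], C_k[i,j']] = 1} has cardinality exactly t + 1 (the beamformer set generated for each delivered part consists of the target user together with the t targeted users caching that part). -/
/-- Placement matrix: `Vmat K t p k = 1` iff `(k - p) mod K ∈ {0, …, t-1}`. -/
def Vmat (K t : ℕ) (p k : ℕ) : ℕ :=
  if 0 ≤ ((k : ℤ) - (p : ℤ)) % (K : ℤ) ∧ ((k : ℤ) - (p : ℤ)) % (K : ℤ) < (t : ℤ)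
  then 1 else 0

/-- Delivery prime matrix `C_1`. -/
def C1 (K t : ℕ) (i j : ℕ) : ℕ :=
  if j ≤ t then j
  else if j + i - 1 ≤ K then j + i - 1 else j + i - 1 - (K - t)

/-- Delivery prime matrix `R_1`. -/
def R1 (K t : ℕ) (i j : ℕ) : ℕ :=
  if j ≤ t then (if i ≤ K - 2 * t + j then t + i else i + 2 * t - K)
  else 1

/-- Round-`k` matrix `C_k`, entrywise circular increment of `C_1`. -/
def Cmat (K t : ℕ) (k i j : ℕ) : ℕ := ((C1 K t i j + k - 2) % K) + 1

/-- Round-`k` matrix `R_k`, entrywise circular increment of `R_1`. -/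
def Rmat (K t : ℕ) (k i j : ℕ) : ℕ := ((R1 K t i j + k - 2) % K) + 1

/-- For indices in `[1, K]`, the cyclic distance from `p` to `c` is less than `t` iff `c` lies in
the window of length `t` starting at `p`, possibly wrapping around. -/
theorem emod_sub_lt_iff {K t p c : ℕ} (hp : 1 ≤ p) (hpK : p ≤ K) (hc : 1 ≤ c) (hcK : c ≤ K) :
    ((c : ℤ) - p) % K < t ↔ (p ≤ c ∧ c < p + t) ∨ (c < p ∧ c + K < p + t) := by
  rcases le_or_gt p c with h | h
  · rw [Int.emod_eq_of_lt (by omega) (by omega)]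
    omega
  · rw [← Int.add_emod_right, Int.emod_eq_of_lt (by omega) (by omega)]
    omega

/-- Circularly shifting both arguments by the same amount preserves residues of differences. -/
theorem shift_sub_emod {K k p c : ℕ} (hk : 1 ≤ k) (hp : 1 ≤ p) (hc : 1 ≤ c) :
    ((((c + k - 2) % K + 1 : ℕ) : ℤ) - (((p + k - 2) % K + 1 : ℕ) : ℤ)) % K
      = ((c : ℤ) - p) % K := by
  have h : ((c : ℤ) - p) = ((c + k - 2 : ℕ) : ℤ) - ((p + k - 2 : ℕ) : ℤ) := by omega
  rw [h]
  push_cast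
  rw [add_sub_add_right_eq_sub, ← Int.sub_emod]

theorem shift_injOn {K k : ℕ} (hk : 1 ≤ k) :
    Set.InjOn (fun x => (x + k - 2) % K + 1) (Finset.Icc 1 K : Finset ℕ) := by
  intro a ha b hb hab
  simp only [Finset.coe_Icc, Set.mem_Icc] at ha hb
  have h := shift_sub_emod (K := K) hk hb.1 ha.1
  simp only at hab
  rw [hab, sub_self, Int.zero_emod] at h
  obtain ⟨q, hq⟩ := Int.dvd_of_emod_eq_zero h.symm
  have hq1 : q < 1 := by
    by_contra! hcon
    nlinarith
  have hq2 : -1 < q := by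
    by_contra! hcon
    nlinarith
  obtain rfl : q = 0 := by omega
  omega

/-- The circular window of length `t` starting at `p` has `t` elements. -/
theorem card_window {K t p : ℕ} (htK : t ≤ K) (hp : 1 ≤ p) (hpK : p ≤ K) :
    ((Finset.Icc 1 K).filter
      (fun c => (p ≤ c ∧ c < p + t) ∨ (c < p ∧ c + K < p + t))).card = t := by
  have h : (Finset.Icc 1 K).filter
      (fun c => (p ≤ c ∧ c < p + t) ∨ (c < p ∧ c + K < p + t))
      = (Finset.range t).image (fun s => if p + s ≤ K then p + s else p + s - K) := by
    ext c
    simp only [Finset.mem_filter, Finset.mem_Icc, Finset.mem_image, Finset.mem_range]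
    constructor
    · rintro ⟨hc, h | h⟩
      · exact ⟨c - p, by omega, by split_ifs <;> omega⟩
      · exact ⟨c + K - p, by omega, by split_ifs <;> omega⟩
    · rintro ⟨s, hs, rfl⟩
      split_ifs <;> omega
  rw [h, Finset.card_image_of_injOn, Finset.card_range]
  intro a ha b hb hab
  simp only [Finset.coe_range, Set.mem_Iio] at ha hb
  simp only at hab
  split_ifs at hab <;> omega

theorem C1_mem_Icc {K t L i j : ℕ} (hKtL : t + L ≤ K) (hi : i ∈ Finset.Icc 1 (K - t))
    (hj : j ∈ Finset.Icc 1 (t + L)) : C1 K t i j ∈ Finset.Icc 1 K := by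
  simp only [Finset.mem_Icc, C1] at *
  split_ifs <;> omega

theorem R1_mem_Icc {K t L i j : ℕ} (hK : 0 < K) (htL : t ≤ L) (hKtL : t + L ≤ K)
    (hi : i ∈ Finset.Icc 1 (K - t)) : R1 K t i j ∈ Finset.Icc 1 K := by
  simp only [Finset.mem_Icc, R1] at *
  split_ifs <;> omega

theorem C1_notMem_window {K t L i j : ℕ} (htL : t ≤ L) (hKtL : t + L ≤ K)
    (hi : i ∈ Finset.Icc 1 (K - t)) (hj : j ∈ Finset.Icc 1 (t + L)) :
    ¬ ((R1 K t i j ≤ C1 K t i j ∧ C1 K t i j < R1 K t i j + t) ∨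
      (C1 K t i j < R1 K t i j ∧ C1 K t i j + K < R1 K t i j + t)) := by
  simp only [Finset.mem_Icc, R1, C1] at *
  split_ifs <;> omega

/-- Every user caching the part `R1 K t i j` is targeted in row `i` of `C1`. -/
theorem exists_C1_eq_of_mem_window {K t L i j c : ℕ} (htL : t ≤ L)
    (hKtL : t + L ≤ K) (hi : i ∈ Finset.Icc 1 (K - t))
    (hc : c ∈ Finset.Icc 1 K)
    (h : (R1 K t i j ≤ c ∧ c < R1 K t i j + t) ∨ (c < R1 K t i j ∧ c + K < R1 K t i j + t)) :
    ∃ j' ∈ Finset.Icc 1 (t + L), C1 K t i j' = c := by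
  simp only [Finset.mem_Icc, R1, C1] at *
  by_cases h1 : c ≤ t
  · exact ⟨c, by omega, by simp [h1]⟩
  by_cases h2 : t + i ≤ c
  · refine ⟨c + 1 - i, ?_, ?_⟩
    · split_ifs at h <;> omega
    · split_ifs <;> omega
  · refine ⟨c + 1 + (K - t) - i, ?_, ?_⟩
    · split_ifs at h <;> omega
    · split_ifs <;> omega

theorem stmt_10 (K t L : ℕ) (hK : 0 < K) (ht : 0 < t) (hL : 0 < L)
    (htL : t ≤ L) (hKtL : t + L ≤ K) :
    ∀ k ∈ Finset.Icc 1 K, ∀ i ∈ Finset.Icc 1 (K - t), ∀ j ∈ Finset.Icc 1 (t + L),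
      (insert (Cmat K t k i j)
        (((Finset.Icc 1 (t + L)).filter
          (fun j' => Vmat K t (Rmat K t k i j) (Cmat K t k i j') = 1)).image
            (fun j' => Cmat K t k i j'))).card = t + 1 := by
  intro k hk i hi j hj
  have hk1 : 1 ≤ k := (Finset.mem_Icc.mp hk).1
  have hR := R1_mem_Icc (j := j) hK htL hKtL hi
  have hR' := Finset.mem_Icc.mp hR
  have hV : ∀ j' ∈ Finset.Icc 1 (t + L),
      (Vmat K t (Rmat K t k i j) (Cmat K t k i j') = 1 ↔
        (R1 K t i j ≤ C1 K t i j' ∧ C1 K t i j' < R1 K t i j + t) ∨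
          (C1 K t i j' < R1 K t i j ∧ C1 K t i j' + K < R1 K t i j + t)) := by
    intro j' hj'
    have hC := Finset.mem_Icc.mp (C1_mem_Icc hKtL hi hj')
    rw [← emod_sub_lt_iff hR'.1 hR'.2 hC.1 hC.2, Vmat, Rmat, Cmat,
      shift_sub_emod hk1 hR'.1 hC.1]
    have hnonneg := Int.emod_nonneg ((C1 K t i j' : ℤ) - R1 K t i j) (b := (K : ℤ)) (by omega)
    simp [hnonneg]
  set W := (Finset.Icc 1 K).filter
    (fun c => (R1 K t i j ≤ c ∧ c < R1 K t i j + t) ∨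
      (c < R1 K t i j ∧ c + K < R1 K t i j + t)) with hW
  have himage : ((Finset.Icc 1 (t + L)).filter
      (fun j' => Vmat K t (Rmat K t k i j) (Cmat K t k i j') = 1)).image
        (fun j' => Cmat K t k i j') = W.image (fun x => (x + k - 2) % K + 1) := by
    ext u
    simp only [Finset.mem_image, Finset.mem_filter, hW]
    constructor
    · rintro ⟨j', ⟨hj', hv⟩, rfl⟩
      exact ⟨C1 K t i j', ⟨C1_mem_Icc hKtL hi hj', (hV j' hj').mp hv⟩, rfl⟩
    · rintro ⟨c, ⟨hc, hw⟩, rfl⟩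
      obtain ⟨j', hj', rfl⟩ := exists_C1_eq_of_mem_window htL hKtL hi hc hw
      exact ⟨j', ⟨hj', (hV j' hj').mpr hw⟩, rfl⟩
  have hnot : C1 K t i j ∉ W := fun h =>
    C1_notMem_window htL hKtL hi hj (Finset.mem_filter.mp h).2
  have hsub : insert (C1 K t i j) W ⊆ Finset.Icc 1 K :=
    Finset.insert_subset (C1_mem_Icc hKtL hi hj) (Finset.filter_subset _ _)
  have hinsert : insert (Cmat K t k i j) (W.image (fun x => (x + k - 2) % K + 1))
      = (insert (C1 K t i j) W).image (fun x => (x + k - 2) % K + 1) :=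
    (Finset.image_insert _ _ _).symm
  rw [himage, hinsert,
    Finset.card_image_of_injOn ((shift_injOn hk1).mono (Finset.coe_subset.mpr hsub)),
    Finset.card_insert_of_notMem hnot, card_window (by omega) hR'.1 hR'.2]
end

section
/- (Lemma 1, combinatorial form) In every transmission interval exactly t + L users are served interference-free: for all k ∈ [K] and i ∈ {1,…,K−t}, the t+L targeted users C_k[i,1],…,C_k[i,t+L] are pairwise distinct; for each j ∈ {1,…,t+L} the delivered part satisfies V[R_k[i,j], C_k[i,j]] = 0 (it is missing from its target's cache); and each delivered part R_k[i,j] is cached by exactly t of the other t+L−1 targeted users, so it needs to be zero-forced at exactly L−1 users. -/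
theorem C1_mem {K t L i j : ℕ} (hKtL : t + L ≤ K) (hi : 1 ≤ i ∧ i ≤ K - t)
    (hj : 1 ≤ j ∧ j ≤ t + L) : 1 ≤ C1 K t i j ∧ C1 K t i j ≤ K := by
  unfold C1; split_ifs <;> omega

theorem R1_mem {K t i j : ℕ} (h : 2 * t ≤ K) (hi : 1 ≤ i ∧ i ≤ K - t)
    (hj : 1 ≤ j) : 1 ≤ R1 K t i j ∧ R1 K t i j ≤ K := by
  unfold R1; split_ifs <;> omega

theorem C1_injOn {K t L i j j' : ℕ} (hKtL : t + L ≤ K) (hi : 1 ≤ i ∧ i ≤ K - t)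
    (hj : 1 ≤ j ∧ j ≤ t + L) (hj' : 1 ≤ j' ∧ j' ≤ t + L)
    (h : C1 K t i j = C1 K t i j') : j = j' := by
  unfold C1 at h; split_ifs at h <;> omega

theorem eq_of_shift_mod_eq {K k a b : ℕ} (hk : 1 ≤ k) (ha : 1 ≤ a ∧ a ≤ K)
    (hb : 1 ≤ b ∧ b ≤ K) (h : (a + k - 2) % K = (b + k - 2) % K) : a = b := by
  have h1 : (a - 1) + (k - 1) ≡ (b - 1) + (k - 1) [MOD K] := by
    unfold Nat.ModEq
    convert h using 2 <;> omega
  have h2 := (Nat.ModEq.add_right_cancel' (k - 1) h1).eq_of_lt_of_lt (by omega) (by omega)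
  omega

theorem Vmat_shift {K t k p c : ℕ} (hk : 1 ≤ k) (hp : 1 ≤ p) (hc : 1 ≤ c) :
    Vmat K t ((p + k - 2) % K + 1) ((c + k - 2) % K + 1) = Vmat K t p c := by
  have h : ((((c + k - 2) % K + 1 : ℕ) : ℤ) - (((p + k - 2) % K + 1 : ℕ) : ℤ)) % (K : ℤ)
      = ((c : ℤ) - (p : ℤ)) % (K : ℤ) := by
    push_cast [Nat.cast_sub (show 2 ≤ c + k by omega), Nat.cast_sub (show 2 ≤ p + k by omega)]
    rw [add_sub_add_right_eq_sub, ← Int.sub_emod]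
    congr 1
    ring
  unfold Vmat
  rw [h]

/-- For indices in `[1, K]`, the users caching part `p` form the cyclic window starting at `p`. -/
theorem Vmat_eq_one_iff {K t p c : ℕ} (hp : 1 ≤ p ∧ p ≤ K) (hc : 1 ≤ c ∧ c ≤ K) :
    Vmat K t p c = 1 ↔ (p ≤ c ∧ c < p + t) ∨ (c < p ∧ c + K < p + t) := by
  have h : ((c : ℤ) - p) % K = if p ≤ c then (c : ℤ) - p else (c : ℤ) - p + K := by
    split_ifs with hpc
    · exact Int.emod_eq_of_lt (by omega) (by omega)
    · rw [← Int.add_emod_right]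
      exact Int.emod_eq_of_lt (by omega) (by omega)
  unfold Vmat
  rw [h]
  split_ifs <;> simp <;> omega

theorem Vmat_eq_zero_of_ne_one {K t p c : ℕ} (h : Vmat K t p c ≠ 1) : Vmat K t p c = 0 := by
  unfold Vmat at *
  split_ifs at * <;> simp_all

theorem Vmat_R1_C1_ne_one {K t L i j : ℕ} (htL : t ≤ L) (hKtL : t + L ≤ K)
    (hi : 1 ≤ i ∧ i ≤ K - t) (hj : 1 ≤ j ∧ j ≤ t + L) :
    Vmat K t (R1 K t i j) (C1 K t i j) ≠ 1 := by
  rw [Ne, Vmat_eq_one_iff (R1_mem (by omega) hi hj.1) (C1_mem hKtL hi hj)]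
  unfold R1 C1
  split_ifs <;> omega

theorem card_filter_Vmat_R1_C1 {K t L i j : ℕ} (htL : t ≤ L) (hKtL : t + L ≤ K)
    (hi : 1 ≤ i ∧ i ≤ K - t) (hj : 1 ≤ j ∧ j ≤ t + L) :
    ((Finset.Icc 1 (t + L)).filter
      (fun j' => Vmat K t (R1 K t i j) (C1 K t i j') = 1)).card = t := by
  have key : ∀ a b c d : ℕ, b < c → (b + 1 - a) + (d + 1 - c) = t →
      (∀ j', (1 ≤ j' ∧ j' ≤ t + L) → (((R1 K t i j ≤ C1 K t i j' ∧
        C1 K t i j' < R1 K t i j + t) ∨ (C1 K t i j' < R1 K t i j ∧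
        C1 K t i j' + K < R1 K t i j + t)) ↔ (a ≤ j' ∧ j' ≤ b) ∨ (c ≤ j' ∧ j' ≤ d))) →
      1 ≤ a → d ≤ t + L → b ≤ t + L → ((Finset.Icc 1 (t + L)).filter
      (fun j' => Vmat K t (R1 K t i j) (C1 K t i j') = 1)).card = t := by
    intro a b c d hbc hsum hiff ha hd hb
    have heq : (Finset.Icc 1 (t + L)).filter
        (fun j' => Vmat K t (R1 K t i j) (C1 K t i j') = 1)
        = Finset.Icc a b ∪ Finset.Icc c d := by
      ext j'
      simp only [Finset.mem_filter, Finset.mem_union, Finset.mem_Icc]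
      constructor
      · rintro ⟨hj', hV⟩
        rw [Vmat_eq_one_iff (R1_mem (by omega) hi hj.1) (C1_mem hKtL hi hj')] at hV
        exact (hiff j' hj').1 hV
      · intro h
        have hj' : 1 ≤ j' ∧ j' ≤ t + L := by omega
        refine ⟨hj', ?_⟩
        rw [Vmat_eq_one_iff (R1_mem (by omega) hi hj.1) (C1_mem hKtL hi hj')]
        exact (hiff j' hj').2 h
    rw [heq, Finset.card_union_of_disjoint, Nat.card_Icc, Nat.card_Icc, hsum]
    rw [Finset.disjoint_left]
    intro x hx hx'
    simp only [Finset.mem_Icc] at hx hx'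
    omega
  by_cases hjt : j ≤ t
  · by_cases hij : i ≤ K - 2 * t + j
    · refine key 1 (2 * t + i - 1 - K) (t + 1) (min (2 * t) (K - i + 1))
        (by omega) (by omega) ?_ le_rfl (by omega) (by omega)
      intro j' hj'
      simp only [R1, C1, hjt, hij, if_true]
      split_ifs <;> omega
    · refine key (i + 2 * t - K) t (K - i + 2) (2 * t)
        (by omega) (by omega) ?_ (by omega) (by omega) (by omega)
      intro j' hj'
      simp only [R1, C1, hjt, hij, if_true, if_false]
      split_ifs <;> omega
  · refine key 1 t (t + 1) t (by omega) (by omega) ?_ le_rfl (by omega) (by omega)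
    intro j' hj'
    simp only [R1, C1, hjt, if_false]
    split_ifs <;> omega

theorem stmt_16 (K t L : ℕ) (hK : 0 < K) (ht : 0 < t) (hL : 0 < L)
    (htL : t ≤ L) (hKtL : t + L ≤ K) :
    ∀ k ∈ Finset.Icc 1 K, ∀ i ∈ Finset.Icc 1 (K - t),
      (∀ j ∈ Finset.Icc 1 (t + L), ∀ j' ∈ Finset.Icc 1 (t + L),
        j ≠ j' → Cmat K t k i j ≠ Cmat K t k i j') ∧
      (∀ j ∈ Finset.Icc 1 (t + L),
        Vmat K t (Rmat K t k i j) (Cmat K t k i j) = 0) ∧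
      (∀ j ∈ Finset.Icc 1 (t + L),
        ((Finset.Icc 1 (t + L)).filter
          (fun j' => j' ≠ j ∧ Vmat K t (Rmat K t k i j) (Cmat K t k i j') = 1)).card
          = t) := by
  intro k hk i hi
  rw [Finset.mem_Icc] at hk hi
  have hV : ∀ j ∈ Finset.Icc 1 (t + L), ∀ j' ∈ Finset.Icc 1 (t + L),
      Vmat K t (Rmat K t k i j) (Cmat K t k i j') = Vmat K t (R1 K t i j) (C1 K t i j') := by
    intro j hj j' hj'
    rw [Finset.mem_Icc] at hj hj'
    exact Vmat_shift hk.1 (R1_mem (by omega) hi hj.1).1 (C1_mem hKtL hi hj').1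
  refine ⟨fun j hj j' hj' hne heq => hne ?_, fun j hj => ?_, fun j hj => ?_⟩
  · rw [Finset.mem_Icc] at hj hj'
    exact C1_injOn hKtL hi hj hj' (eq_of_shift_mod_eq hk.1 (C1_mem hKtL hi hj)
      (C1_mem hKtL hi hj') (Nat.succ_injective heq))
  · rw [hV j hj j hj]
    exact Vmat_eq_zero_of_ne_one (Vmat_R1_C1_ne_one htL hKtL hi (Finset.mem_Icc.1 hj))
  · refine Eq.trans (congrArg Finset.card (Finset.filter_congr fun j' hj' => ?_))
      (card_filter_Vmat_R1_C1 htL hKtL hi (Finset.mem_Icc.1 hj))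
    rw [hV j hj j' hj', and_iff_right_iff_imp]
    rintro h rfl
    exact Vmat_R1_C1_ne_one htL hKtL hi (Finset.mem_Icc.1 hj) h
end

section
/- For each fixed j ∈ {1,…,t} and each user u ∈ [K], there is exactly one round k ∈ [K] such that the vertical column j of round k targets user u, i.e., exactly one k ∈ [K] with ((j + k − 2) mod K) + 1 = u; and within that round, for each p ∈ [K] with V[p,u] = 0, there is exactly one row i ∈ {1,…,K−t} with R_k[i,j] = p. -/
theorem Nat.mod_eq_ite_of_lt_two_mul {a n : ℕ} (h : a < 2 * n) :
    a % n = if a < n then a else a - n := by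
  split_ifs with hlt
  · exact Nat.mod_eq_of_lt hlt
  · rw [Nat.mod_eq_sub_mod (by omega), Nat.mod_eq_of_lt (by omega)]

theorem Int.sub_emod_eq_ite {a b n : ℕ} (ha : a ∈ Finset.Icc 1 n) (hb : b ∈ Finset.Icc 1 n) :
    ((a : ℤ) - b) % n = if b ≤ a then (a : ℤ) - b else a - b + n := by
  rw [Finset.mem_Icc] at ha hb
  split_ifs with hle
  · exact Int.emod_eq_of_lt (by omega) (by omega)
  · rw [← Int.add_emod_right, Int.emod_eq_of_lt (by omega) (by omega)]

theorem add_le_of_Vmat_eq_zero {K t p u : ℕ} (hp : p ∈ Finset.Icc 1 K) (hu : u ∈ Finset.Icc 1 K)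
    (h : Vmat K t p u = 0) : if p ≤ u then p + t ≤ u else p + t ≤ u + K := by
  rw [Vmat, Int.sub_emod_eq_ite hu hp] at h
  rw [Finset.mem_Icc] at hp hu
  grind

theorem Rmat_eq_ite {K t k i j : ℕ} (htK : 2 * t ≤ K) (hj : j ∈ Finset.Icc 1 t)
    (hk : k ∈ Finset.Icc 1 K) (hi : i ∈ Finset.Icc 1 (K - t)) :
    Rmat K t k i j =
      if R1 K t i j + k ≤ K + 1 then R1 K t i j + k - 1 else R1 K t i j + k - 1 - K := by
  rw [Finset.mem_Icc] at hj hk hi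
  have hR : 1 ≤ R1 K t i j ∧ R1 K t i j ≤ K := by
    unfold R1
    split_ifs <;> omega
  rw [Rmat, Nat.mod_eq_ite_of_lt_two_mul (by omega)]
  split_ifs <;> omega

theorem existsUnique_R1_eq {K t j r : ℕ} (htK : 2 * t ≤ K) (hj : j ≤ t)
    (hr : r ∈ Finset.Icc (j + 1) (K - t + j)) :
    ∃! i, i ∈ Finset.Icc 1 (K - t) ∧ R1 K t i j = r := by
  rw [Finset.mem_Icc] at hr
  refine ⟨if t < r then r - t else r + K - 2 * t, ⟨?_, ?_⟩, ?_⟩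
  · rw [Finset.mem_Icc]
    split_ifs <;> omega
  · unfold R1
    split_ifs <;> omega
  · rintro i ⟨hi, hR⟩
    rw [Finset.mem_Icc] at hi
    unfold R1 at hR
    split_ifs at hR ⊢ <;> omega

theorem stmt_18 (K t L : ℕ) (hK : 0 < K) (ht : 0 < t) (hL : 0 < L)
    (htL : t ≤ L) (hKtL : t + L ≤ K) :
    ∀ j ∈ Finset.Icc 1 t, ∀ u ∈ Finset.Icc 1 K,
      (∃! k, k ∈ Finset.Icc 1 K ∧ ((j + k - 2) % K) + 1 = u) ∧
      (∀ k ∈ Finset.Icc 1 K, ((j + k - 2) % K) + 1 = u →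
        ∀ p ∈ Finset.Icc 1 K, Vmat K t p u = 0 →
          ∃! i, i ∈ Finset.Icc 1 (K - t) ∧ Rmat K t k i j = p) := by
  intro j hj u hu
  have hj' := Finset.mem_Icc.mp hj
  have hu' := Finset.mem_Icc.mp hu
  have htK : 2 * t ≤ K := by omega
  have hmod : ∀ k ∈ Finset.Icc 1 K,
      (j + k - 2) % K = if j + k - 2 < K then j + k - 2 else j + k - 2 - K := by
    intro k hk
    rw [Finset.mem_Icc] at hk
    exact Nat.mod_eq_ite_of_lt_two_mul (by omega)
  refine ⟨?_, ?_⟩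
  · have hmem : (if j ≤ u then u + 1 - j else u + 1 + K - j) ∈ Finset.Icc 1 K := by
      rw [Finset.mem_Icc]
      split_ifs <;> omega
    refine ⟨if j ≤ u then u + 1 - j else u + 1 + K - j, ⟨hmem, ?_⟩, ?_⟩
    · rw [hmod _ hmem]
      split_ifs <;> omega
    · rintro k ⟨hk, hku⟩
      rw [hmod k hk] at hku
      rw [Finset.mem_Icc] at hk
      split_ifs at hku ⊢ <;> omega
  · intro k hk hku p hp hV
    rw [hmod k hk] at hku
    have hgap := add_le_of_Vmat_eq_zero hp hu hV
    have hk' := Finset.mem_Icc.mp hk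
    have hp' := Finset.mem_Icc.mp hp
    have hr : (if p ≤ u then j + K + p - u else j + p - u) ∈ Finset.Icc (j + 1) (K - t + j) := by
      rw [Finset.mem_Icc]
      split_ifs at hgap ⊢ <;> omega
    refine (existsUnique_congr fun i => and_congr_right fun hi => ?_).mpr
      (existsUnique_R1_eq htK hj'.2 hr)
    have hR : 1 ≤ R1 K t i j ∧ R1 K t i j ≤ K := by
      rw [Finset.mem_Icc] at hi
      unfold R1
      split_ifs <;> omega
    rw [Rmat_eq_ite htK hj hk hi]
    rw [Finset.mem_Icc] at hr
    split_ifs at hku hgap hr ⊢ <;> omega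
end
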